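/- Let μ(m) be the m-th Maclaurin coefficient of the function F(z) = (1/(1−z)) · exp(Σ_{d=1}^∞ c_d z^d) (analytic on the open unit disc). Then log μ(n) = (3/2)·n^{1/3} + O(n^{1/6}) as n → ∞; in particular μ(n) ≤ exp((3/2)·n^{1/3} + O(1)) and μ(n) ≥ exp((3/2)·n^{1/3} + O(n^{1/6})). -/

import Mathlib

open scoped Classical
open Function

namespace IterMap

noncomputable section

/-- A vertex `v` is cyclic for `f` if some positive iterate of `f` fixes `v`. -/
def IsCyclic {n : ℕ} (f : Fin n → Fin n) (v : Fin n) : Prop :=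
  ∃ t, 0 < t ∧ f^[t] v = v

theorem isCyclic_apply {n : ℕ} {f : Fin n → Fin n} {v : Fin n} (h : IsCyclic f v) :
    IsCyclic f (f v) := by
  obtain ⟨t, ht, hv⟩ := h
  refine ⟨t, ht, ?_⟩
  calc f^[t] (f v) = f^[t + 1] v := (Function.iterate_succ_apply f t v).symm
    _ = f (f^[t] v) := Function.iterate_succ_apply' f t v
    _ = f v := by rw [hv]

/-- The permutation induced by `f` on its cyclic vertices. -/
def cyclicPerm {n : ℕ} (f : Fin n → Fin n) :
    Equiv.Perm {v : Fin n // IsCyclic f v} :=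
  Equiv.ofBijective (fun v => ⟨f v.1, isCyclic_apply v.2⟩) (by
    rw [← Finite.injective_iff_bijective]
    intro u v huv
    have h1 : f u.1 = f v.1 := congrArg Subtype.val huv
    obtain ⟨s, hs, hsu⟩ := u.2
    obtain ⟨t, ht, htv⟩ := v.2
    have hu : f^[s * t] u.1 = u.1 := by
      rw [Function.iterate_mul]
      exact Function.iterate_fixed hsu t
    have hv : f^[s * t] v.1 = v.1 := by
      rw [mul_comm, Function.iterate_mul]
      exact Function.iterate_fixed htv s
    have hst : 0 < s * t := Nat.mul_pos hs ht
    obtain ⟨k, hk⟩ : ∃ k, s * t = k + 1 := ⟨s * t - 1, by omega⟩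
    apply Subtype.ext
    calc u.1 = f^[s * t] u.1 := hu.symm
      _ = f^[k] (f u.1) := by rw [hk, Function.iterate_succ_apply]
      _ = f^[k] (f v.1) := by rw [h1]
      _ = f^[s * t] v.1 := by rw [hk, Function.iterate_succ_apply]
      _ = v.1 := hv)

/-- `T f`: the (eventual) period of the sequence of iterates of `f`. -/
def T {n : ℕ} (f : Fin n → Fin n) : ℕ :=
  sInf {T : ℕ | 0 < T ∧ ∀ m, n ≤ m → f^[m + T] = f^[m]}

/-- `B f`: the product of the lengths of the cycles of `f`. -/
def B {n : ℕ} (f : Fin n → Fin n) : ℕ :=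
  (cyclicPerm f).cycleType.prod

/-- `Z f`: the number of cyclic vertices of `f`. -/
def Z {n : ℕ} (f : Fin n → Fin n) : ℕ :=
  Nat.card {v : Fin n // IsCyclic f v}

/-- `O f`: the number of distinct positive iterates of `f`. -/
def O {n : ℕ} (f : Fin n → Fin n) : ℕ :=
  Nat.card {g : Fin n → Fin n // ∃ t, 0 < t ∧ g = f^[t]}

/-- `f` is connected if its functional graph has one weak component. -/
def Connected {n : ℕ} (f : Fin n → Fin n) : Prop :=
  ∀ u v : Fin n, ∃ s t : ℕ, f^[s] u = f^[t] v

/-- The set of connected mappings on `[n]`. -/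
def Un (n : ℕ) : Finset (Fin n → Fin n) :=
  Finset.univ.filter fun f => Connected f

/-- `kappa n`: the average cycle length of a uniform random connected mapping. -/
def kappa (n : ℕ) : ℝ :=
  (∑ f ∈ Un n, (Z f : ℝ)) / (Un n).card

def c (d : ℕ) : ℝ :=
  ((kappa d - 1) / d) * Real.exp (-(d : ℝ)) *
    ∑ k ∈ Finset.range d, (d : ℝ) ^ k / (k.factorial : ℝ)

def F (z : ℝ) : ℝ := (1 / (1 - z)) * Real.exp (∑' d : ℕ, c d * z ^ d)

def mu (m : ℕ) : ℝ := iteratedDeriv m F 0 / (m.factorial : ℝ)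

def g (s : ℝ) : ℝ := ∑' d : ℕ, c d * Real.exp (-(d : ℝ) * s)

/-- `M m`: the average order of a uniform random permutation of `[m]`. -/
def M (m : ℕ) : ℝ :=
  (∑ σ : Equiv.Perm (Fin m), (orderOf σ : ℝ)) / (m.factorial : ℝ)

def I : ℝ :=
  ∫ t in Set.Ioi (0 : ℝ), Real.log (Real.log (Real.exp 1 / (1 - Real.exp (-t))))

def beta0 : ℝ := Real.sqrt (8 * I)

def k0 : ℝ := (3 / 2) * (3 * I) ^ ((2 : ℝ) / 3)

end

noncomputable section

def RS {d : ℕ} (S : Finset (Fin d)) : Finset (Fin d → Fin d) :=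
  Finset.univ.filter fun f => ∀ u, ∃ t, f^[t] u ∈ S

theorem mem_RS {d : ℕ} {S : Finset (Fin d)} {f : Fin d → Fin d} :
    f ∈ RS S ↔ ∀ u, ∃ t, f^[t] u ∈ S := by simp [RS]

def fh {d : ℕ} (f : Fin d → Fin d) (T : Finset (Fin d)) (u : Fin d) : Fin d :=
  if h : ∃ t, f^[t] u ∈ T then f^[Nat.find h] u else u

theorem fh_eq {d : ℕ} {f : Fin d → Fin d} {T : Finset (Fin d)} {u : Fin d} {t : ℕ}
    (ht : f^[t] u ∈ T) (hlt : ∀ i < t, f^[i] u ∉ T) : fh f T u = f^[t] u := by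
  have h : ∃ t, f^[t] u ∈ T := ⟨t, ht⟩
  have : Nat.find h = t := (Nat.find_eq_iff h).2 ⟨ht, hlt⟩
  rw [fh, dif_pos h, this]

theorem exists_first {d : ℕ} {f : Fin d → Fin d} {T : Finset (Fin d)} (hf : f ∈ RS T)
    (u : Fin d) : ∃ t, f^[t] u ∈ T ∧ ∀ i < t, f^[i] u ∉ T := by
  have h := mem_RS.1 hf u
  exact ⟨Nat.find h, Nat.find_spec h, fun i hi => Nat.find_min h hi⟩

theorem fh_mem {d : ℕ} {f : Fin d → Fin d} {T : Finset (Fin d)} (hf : f ∈ RS T)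
    (u : Fin d) : fh f T u ∈ T := by
  obtain ⟨t, h1, h2⟩ := exists_first hf u
  rw [fh_eq h1 h2]; exact h1

theorem iter_agree {d : ℕ} {f f' : Fin d → Fin d} {T : Finset (Fin d)}
    (h : ∀ v, v ∉ T → f v = f' v) (u : Fin d) (t : ℕ) (hlt : ∀ i < t, f^[i] u ∉ T) :
    ∀ i ≤ t, f'^[i] u = f^[i] u := by
  intro i
  induction i with
  | zero => intro _; rfl
  | succ k ih =>
    intro hk
    rw [iterate_succ_apply', iterate_succ_apply', ih (by omega), h _ (hlt k (by omega))]

theorem RS_agree {d : ℕ} {f f' : Fin d → Fin d} {T : Finset (Fin d)}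
    (h : ∀ v, v ∉ T → f v = f' v) (hf : f ∈ RS T) :
    f' ∈ RS T ∧ ∀ u, fh f' T u = fh f T u := by
  have key : ∀ u, ∃ t, f'^[t] u ∈ T ∧ fh f' T u = fh f T u := by
    intro u
    obtain ⟨t, h1, h2⟩ := exists_first hf u
    have ha := iter_agree h u t h2
    have h1' : f'^[t] u ∈ T := by rw [ha t le_rfl]; exact h1
    refine ⟨t, h1', ?_⟩
    rw [fh_eq h1 h2, fh_eq h1' (fun i hi => by rw [ha i hi.le]; exact h2 i hi), ha t le_rfl]
  exact ⟨mem_RS.2 fun u => (key u).imp fun t ht => ht.1, fun u => (key u).choose_spec.2⟩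

theorem RS_mono {d : ℕ} {S T : Finset (Fin d)} (h : S ⊆ T) : RS S ⊆ RS T := by
  intro f hf
  exact mem_RS.2 fun u => (mem_RS.1 hf u).imp fun t ht => h ht

theorem RS_erase_iff {d : ℕ} {f : Fin d → Fin d} {T : Finset (Fin d)} {x : Fin d} (hx : x ∈ T) :
    f ∈ RS (T.erase x) ↔ f ∈ RS T ∧ fh f T (f x) ≠ x := by
  constructor
  · intro hf
    refine ⟨RS_mono (Finset.erase_subset _ _) hf, ?_⟩
    intro hfx
    obtain ⟨t, h1, h2⟩ := exists_first (RS_mono (Finset.erase_subset _ _) hf) (f x)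
    rw [fh_eq h1 h2] at hfx
    have hper : f^[t+1] x = x := by rw [iterate_succ_apply]; exact hfx
    obtain ⟨s, hs⟩ := mem_RS.1 hf x
    have hmod : f^[s % (t+1)] x = f^[s] x := by
      exact (show IsPeriodicPt f (t+1) x from hper).iterate_mod_apply s
    rw [← hmod] at hs
    have hlt : s % (t+1) < t + 1 := Nat.mod_lt _ (by omega)
    rcases hk : s % (t+1) with _ | k
    · rw [hk] at hs; simp at hs
    · rw [hk, iterate_succ_apply] at hs
      exact h2 k (by omega) (Finset.mem_of_mem_erase hs)
  · rintro ⟨hf, hne⟩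
    rw [mem_RS]
    intro u
    obtain ⟨t, h1, h2⟩ := exists_first hf u
    by_cases hux : f^[t] u = x
    · obtain ⟨s, h3, h4⟩ := exists_first hf (f x)
      rw [fh_eq h3 h4] at hne
      refine ⟨s + (t + 1), ?_⟩
      rw [iterate_add_apply, iterate_succ_apply', hux]
      exact Finset.mem_erase.2 ⟨hne, h3⟩
    · exact ⟨t, Finset.mem_erase.2 ⟨hux, h1⟩⟩

theorem card_erase {d : ℕ} (T : Finset (Fin d)) {x : Fin d} (hx : x ∈ T) :
    (RS (T.erase x)).card * d =
      ∑ f ∈ RS T, (Finset.univ.filter fun u => fh f T u ≠ x).card := by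
  rw [← Finset.card_sigma]
  have : (RS (T.erase x)).card * d = ((RS (T.erase x)) ×ˢ (Finset.univ : Finset (Fin d))).card := by
    simp
  rw [this]
  have hag : ∀ (f : Fin d → Fin d) (w : Fin d), ∀ v, v ∉ T → f v = update f x w v := by
    intro f w v hv
    rw [update_of_ne]; rintro rfl; exact hv hx
  refine Finset.card_bij' (fun p _ => ⟨update p.1 x p.2, p.1 x⟩) (fun q _ => (update q.1 x q.2, q.1 x))
    ?_ ?_ ?_ ?_
  · rintro ⟨f, w⟩ h
    have h1 := (RS_erase_iff hx).1 (Finset.mem_product.1 h).1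
    have h2 := RS_agree (hag f w) h1.1
    simp only [Finset.mem_sigma, Finset.mem_filter, Finset.mem_univ, true_and]
    exact ⟨h2.1, by rw [h2.2]; exact h1.2⟩
  · rintro ⟨f, u⟩ h
    simp only [Finset.mem_sigma, Finset.mem_filter, Finset.mem_univ, true_and] at h
    have h2 := RS_agree (hag f u) h.1
    simp only [Finset.mem_product, Finset.mem_univ, and_true]
    rw [RS_erase_iff hx]
    refine ⟨h2.1, ?_⟩
    rw [h2.2]; simpa using h.2
  · rintro ⟨f, w⟩ h; simp
  · rintro ⟨f, w⟩ h; simp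

theorem card_sum_erase {d : ℕ} (T : Finset (Fin d)) :
    ∑ x ∈ T, (RS (T.erase x)).card * d = (RS T).card * (d * (T.card - 1)) := by
  rw [Finset.sum_congr rfl fun x hx => card_erase T hx, Finset.sum_comm]
  rw [← smul_eq_mul, ← Finset.sum_const]
  refine Finset.sum_congr rfl fun f hf => ?_
  simp_rw [Finset.card_filter]
  rw [Finset.sum_comm]
  have : ∀ u : Fin d, ∑ x ∈ T, (if fh f T u ≠ x then 1 else 0) = T.card - 1 := by
    intro u
    rw [← Finset.card_filter, Finset.filter_ne, Finset.card_erase_of_mem (fh_mem hf u)]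
  rw [Finset.sum_congr rfl fun u _ => this u]
  simp

theorem card_RS_eq {d : ℕ} {S T : Finset (Fin d)} (h : S.card = T.card) :
    (RS S).card = (RS T).card := by
  obtain ⟨σ, hσ⟩ : ∃ σ : Equiv.Perm (Fin d), S.map σ.toEmbedding = T := by
    obtain ⟨e⟩ : Nonempty (S ≃ T) := ⟨Finset.equivOfCardEq h⟩
    refine ⟨e.extendSubtype, ?_⟩
    apply Finset.eq_of_subset_of_card_le
    · intro x hx
      obtain ⟨y, hy, rfl⟩ := Finset.mem_map.1 hx
      exact e.extendSubtype_mem y hy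
    · simp [h]
  refine Finset.card_bij' (fun f _ => σ ∘ f ∘ σ.symm) (fun f _ => σ.symm ∘ f ∘ σ) ?_ ?_ ?_ ?_
  · intro f hf
    rw [mem_RS] at hf ⊢
    intro u
    obtain ⟨t, ht⟩ := hf (σ.symm u)
    have hs : Semiconj σ f (σ ∘ f ∘ σ.symm) := fun x => by simp
    refine ⟨t, ?_⟩
    have := (hs.iterate_right t) (σ.symm u)
    rw [Equiv.apply_symm_apply] at this
    rw [← this, ← hσ]
    exact Finset.mem_map_of_mem _ ht
  · intro f hf
    rw [mem_RS] at hf ⊢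
    intro u
    obtain ⟨t, ht⟩ := hf (σ u)
    have hs : Semiconj σ (σ.symm ∘ f ∘ σ) f := fun x => by simp
    refine ⟨t, ?_⟩
    have := (hs.iterate_right t) u
    rw [← this, ← hσ] at ht
    simpa using ht
  · intro f hf; funext x; simp
  · intro f hf; funext x; simp

theorem card_RS {d : ℕ} (S : Finset (Fin d)) (hS : S.Nonempty) :
    (RS S).card = S.card * d ^ (d - 1) := by
  induction' hj : d - S.card with j ih generalizing S
  · have hle := Finset.card_le_univ S
    simp only [Fintype.card_fin] at hle
    have hd : S.card = d := by omega
    have hpos := hS.card_pos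
    have : S = Finset.univ := Finset.eq_univ_of_card _ (by simpa using hd)
    subst this
    have : RS (Finset.univ : Finset (Fin d)) = Finset.univ := by
      ext f; simp [mem_RS]
    rw [this]
    simp
    rw [← pow_succ']; congr 1; omega
  · have hlt : S.card < Finset.univ.card (α := Fin d) := by simp; omega
    obtain ⟨x, -, hx⟩ := Finset.exists_mem_notMem_of_card_lt_card hlt
    have hd : 0 < d := by omega
    have hc : (insert x S).card = S.card + 1 := Finset.card_insert_of_notMem hx
    have h1 := ih (insert x S) ⟨x, by simp⟩ (by omega)
    have h2 := card_sum_erase (insert x S)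
    have h3 : ∀ y ∈ insert x S, (RS ((insert x S).erase y)).card * d = (RS S).card * d := by
      intro y hy
      rw [card_RS_eq (S := (insert x S).erase y) (T := S)]
      rw [Finset.card_erase_of_mem hy, hc]; rfl
    rw [Finset.sum_congr rfl h3, Finset.sum_const, h1, hc, smul_eq_mul] at h2
    have h4 : (S.card + 1) * d * (RS S).card = (S.card + 1) * d * (S.card * d ^ (d - 1)) := by
      simp only [Nat.add_sub_cancel] at h2
      linarith
    exact Nat.eq_of_mul_eq_mul_left (by positivity) h4


theorem mem_RS_singleton {d : ℕ} {f : Fin d → Fin d} {v : Fin d} :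
    f ∈ RS {v} ↔ Connected f ∧ IsCyclic f v := by
  simp only [mem_RS, Finset.mem_singleton]
  constructor
  · intro h
    constructor
    · intro u w
      obtain ⟨s, hs⟩ := h u
      obtain ⟨t, ht⟩ := h w
      exact ⟨s, t, hs.trans ht.symm⟩
    · obtain ⟨t, ht⟩ := h (f v)
      exact ⟨t + 1, by omega, by rw [iterate_succ_apply]; exact ht⟩
  · rintro ⟨hc, p, hp, hv⟩ u
    obtain ⟨s, t, hst⟩ := hc u v
    refine ⟨(p * t - t) + s, ?_⟩
    rw [iterate_add_apply, hst, ← iterate_add_apply, Nat.sub_add_cancel (Nat.le_mul_of_pos_left t hp),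
      iterate_mul]
    exact iterate_fixed hv t

theorem Z_eq {d : ℕ} (f : Fin d → Fin d) :
    Z f = (Finset.univ.filter fun v => IsCyclic f v).card := by
  rw [Z, Nat.card_eq_fintype_card, Fintype.card_subtype]

theorem sum_Z (d : ℕ) (hd : 0 < d) : ∑ f ∈ Un d, Z f = d ^ d := by
  have h1 : ∀ f ∈ Un d, Z f = ∑ v : Fin d, if f ∈ RS {v} then 1 else 0 := by
    intro f hf
    rw [Z_eq, Finset.card_filter]
    refine Finset.sum_congr rfl fun v _ => ?_
    have : Connected f := by simpa [Un] using hf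
    simp [mem_RS_singleton, this]
  rw [Finset.sum_congr rfl h1, Finset.sum_comm]
  have h2 : ∀ v : Fin d, (∑ f ∈ Un d, if f ∈ RS {v} then 1 else 0) = d ^ (d - 1) := by
    intro v
    rw [← Finset.card_filter]
    have : (Un d).filter (fun f => f ∈ RS {v}) = RS {v} := by
      ext f
      simp only [Finset.mem_filter, Un, Finset.mem_univ, true_and]
      rw [mem_RS_singleton]; tauto
    rw [this, card_RS _ ⟨v, by simp⟩]; simp
  rw [Finset.sum_congr rfl fun v _ => h2 v]
  simp
  rw [← pow_succ']; congr 1; omega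

theorem Z_eq_minimalPeriod {d : ℕ} {f : Fin d → Fin d} {v : Fin d} (h : f ∈ RS {v}) :
    Z f = minimalPeriod f v := by
  have hc := (mem_RS_singleton.1 h)
  have hpp : v ∈ periodicPts f := by
    obtain ⟨t, ht, hv⟩ := hc.2; exact ⟨t, ht, hv⟩
  have hpos := minimalPeriod_pos_of_mem_periodicPts hpp
  rw [Z_eq]
  have : (Finset.univ.filter fun w => IsCyclic f w) =
      (Finset.range (minimalPeriod f v)).image (fun i => f^[i] v) := by
    ext w
    simp only [Finset.mem_filter, Finset.mem_univ, true_and, Finset.mem_image, Finset.mem_range]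
    constructor
    · intro hw
      obtain ⟨t, ht⟩ := mem_RS.1 (mem_RS_singleton.2 ⟨hc.1, hw⟩) v
      refine ⟨t % minimalPeriod f v, Nat.mod_lt _ hpos, ?_⟩
      rw [iterate_mod_minimalPeriod_eq]
      simpa using ht
    · rintro ⟨i, -, rfl⟩
      refine ⟨minimalPeriod f v, hpos, ?_⟩
      rw [← iterate_add_apply, add_comm, iterate_add_apply, iterate_minimalPeriod]
  rw [this, Finset.card_image_of_injOn, Finset.card_range]
  intro i hi j hj hij
  exact iterate_injOn_Iio_minimalPeriod (by simpa using hi) (by simpa using hj) hij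

theorem card_fixed {d : ℕ} (S : Finset (Fin d)) (ρ : Fin d → Fin d) :
    ((RS S).filter fun f => ∀ x ∈ S, f x = ρ x).card * d ^ S.card = (RS S).card := by
  have : ((RS S).filter fun f => ∀ x ∈ S, f x = ρ x).card * d ^ S.card =
    (((RS S).filter fun f => ∀ x ∈ S, f x = ρ x) ×ˢ (Finset.univ : Finset (S → Fin d))).card := by
    simp
  rw [this]
  refine Finset.card_bij' (fun p _ => fun x => if h : x ∈ S then p.2 ⟨x, h⟩ else p.1 x)
    (fun f _ => ((fun x => if x ∈ S then ρ x else f x), fun x => f x.1)) ?_ ?_ ?_ ?_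
  · rintro ⟨f, τ⟩ h
    simp only [Finset.mem_product, Finset.mem_filter, Finset.mem_univ, and_true] at h
    refine (RS_agree (f := f) ?_ h.1).1
    intro v hv; simp [hv]
  · intro f hf
    simp only [Finset.mem_product, Finset.mem_filter, Finset.mem_univ, and_true]
    refine ⟨(RS_agree (f := f) ?_ hf).1, ?_⟩
    · intro v hv; simp [hv]
    · intro x hx; simp [hx]
  · rintro ⟨f, τ⟩ h
    simp only [Finset.mem_product, Finset.mem_filter, Finset.mem_univ, and_true] at h
    ext x
    · by_cases hx : x ∈ S
      · simp [hx, h.2 x hx]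
      · simp [hx]
    · simp
  · intro f hf
    funext x
    by_cases hx : x ∈ S <;> simp [hx]

def PK (d k : ℕ) : Finset ((Fin d → Fin d) × Fin d) :=
  Finset.univ.filter fun p => p.1 ∈ RS {p.2} ∧ minimalPeriod p.1 p.2 = k

theorem card_fiber {d k : ℕ} (hk : 0 < k) (e : Fin k → Fin d) (he : Injective e) :
    ((PK d k).filter fun p => (fun i : Fin k => p.1^[i] p.2) = e).card * d ^ k =
      k * d ^ (d - 1) := by
  set S := Finset.univ.image e with hS
  have hcard : S.card = k := by rw [hS, Finset.card_image_of_injective _ he]; simp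
  set ρ : Fin d → Fin d := extend e (fun i => e ⟨(i + 1) % k, Nat.mod_lt _ hk⟩) id with hρ
  have hρe : ∀ i, ρ (e i) = e ⟨(i + 1) % k, Nat.mod_lt _ hk⟩ := fun i => he.extend_apply _ _ _
  have h1 := card_fixed S ρ
  rw [card_RS S ⟨e ⟨0, hk⟩, by simp [hS]⟩, hcard] at h1
  rw [← h1]
  congr 1
  refine Finset.card_bij' (fun p _ => p.1) (fun f _ => (f, e ⟨0, hk⟩)) ?_ ?_ ?_ ?_
  · rintro ⟨f, v⟩ h
    simp only [PK, Finset.mem_filter, Finset.mem_univ, true_and] at h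
    obtain ⟨⟨h2, h3⟩, h4⟩ := h
    have hei : ∀ i : Fin k, e i = f^[i] v := fun i => (congrFun h4 i).symm
    simp only [Finset.mem_filter]
    constructor
    · refine RS_mono ?_ h2
      intro x hx
      rw [Finset.mem_singleton] at hx
      subst hx
      rw [hS, Finset.mem_image]
      exact ⟨⟨0, hk⟩, by simp, by rw [hei]; rfl⟩
    · intro x hx
      obtain ⟨i, -, rfl⟩ := Finset.mem_image.1 hx
      rw [hρe, hei, hei, ← iterate_succ_apply' f]
      simp only
      have h5 := iterate_mod_minimalPeriod_eq (f := f) (x := v) (n := i + 1)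
      rw [h3] at h5
      exact h5.symm
  · intro f hf
    simp only [Finset.mem_filter] at hf
    have hfe : ∀ i, f (e i) = e ⟨(i + 1) % k, Nat.mod_lt _ hk⟩ := by
      intro i; rw [hf.2 (e i) (by simp [hS]), hρe]
    have hit : ∀ (j : ℕ) (i : Fin k), f^[j] (e i) = e ⟨(i + j) % k, Nat.mod_lt _ hk⟩ := by
      intro j
      induction j with
      | zero => intro i; simp [Nat.mod_eq_of_lt i.2]
      | succ j ih =>
        intro i
        rw [iterate_succ_apply', ih, hfe]
        congr 2
        simp [Nat.add_assoc]
    simp only [PK, Finset.mem_filter, Finset.mem_univ, true_and]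
    have hper : IsPeriodicPt f k (e ⟨0, hk⟩) := by
      rw [IsPeriodicPt, IsFixedPt, hit]; simp
    refine ⟨⟨?_, ?_⟩, ?_⟩
    · rw [mem_RS]
      intro u
      obtain ⟨t, ht⟩ := mem_RS.1 hf.1 u
      obtain ⟨i, -, hi⟩ := Finset.mem_image.1 ht
      refine ⟨(k - i) + t, ?_⟩
      rw [iterate_add_apply, ← hi, hit, Finset.mem_singleton]
      congr 2
      rw [Nat.add_sub_cancel' i.2.le, Nat.mod_self]
    · apply le_antisymm (hper.minimalPeriod_le hk)
      by_contra hlt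
      push Not at hlt
      have hp : 0 < minimalPeriod f (e ⟨0, hk⟩) := hper.minimalPeriod_pos hk
      have h5 := iterate_minimalPeriod (f := f) (x := e ⟨0, hk⟩)
      rw [hit] at h5
      have h6 := congrArg Fin.val (he h5)
      simp [Nat.mod_eq_of_lt hlt] at h6
      omega
    · funext i
      rw [hit]; simp [Nat.mod_eq_of_lt i.2]
  · rintro ⟨f, v⟩ h
    simp only [Finset.mem_filter] at h
    rw [← h.2]; rfl
  · intro f hf; rfl

theorem card_PK {d k : ℕ} (hk : 0 < k) :
    (PK d k).card * d ^ k = d.descFactorial k * (k * d ^ (d - 1)) := by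
  have hmap : ∀ p ∈ PK d k, (fun i : Fin k => p.1^[i] p.2) ∈
      (Finset.univ.filter fun e : Fin k → Fin d => Injective e) := by
    rintro ⟨f, v⟩ h
    simp only [PK, Finset.mem_filter, Finset.mem_univ, true_and] at h ⊢
    intro i j hij
    apply Fin.ext
    exact iterate_injOn_Iio_minimalPeriod (f := f) (x := v) (by simpa [h.2] using i.2)
      (by simpa [h.2] using j.2) hij
  rw [Finset.card_eq_sum_card_fiberwise hmap, Finset.sum_mul]
  rw [Finset.sum_congr rfl fun e he => card_fiber hk e (Finset.mem_filter.1 he).2]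
  rw [Finset.sum_const, smul_eq_mul]
  congr 1
  rw [← Fintype.card_subtype, Fintype.card_congr (Equiv.subtypeInjectiveEquivEmbedding (Fin k) (Fin d)),
    Fintype.card_embedding_eq]
  simp

theorem card_Un_Z {d k : ℕ} (hk : 0 < k) :
    ((Un d).filter fun f => Z f = k).card * d ^ k = d.descFactorial k * d ^ (d - 1) := by
  have h1 : (PK d k).card = ((Un d).filter fun f => Z f = k).card * k := by
    have hmap : ∀ p ∈ PK d k, p.1 ∈ ((Un d).filter fun f => Z f = k) := by
      rintro ⟨f, v⟩ h
      simp only [PK, Finset.mem_filter, Finset.mem_univ, true_and] at h ⊢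
      rw [Z_eq_minimalPeriod h.1]
      exact ⟨by simpa [Un] using (mem_RS_singleton.1 h.1).1, h.2⟩
    rw [Finset.card_eq_sum_card_fiberwise hmap]
    rw [← smul_eq_mul, ← Finset.sum_const]
    refine Finset.sum_congr rfl fun f hf => ?_
    simp only [Finset.mem_filter, Un, Finset.mem_univ, true_and] at hf
    rw [← hf.2, Z_eq]
    refine Finset.card_bij' (fun p _ => p.2) (fun v _ => (f, v)) ?_ ?_ ?_ ?_
    · rintro ⟨f', v⟩ h
      simp only [PK, Finset.mem_filter, Finset.mem_univ, true_and] at h ⊢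
      obtain ⟨h, rfl⟩ := h
      exact (mem_RS_singleton.1 h.1).2
    · intro v hv
      simp only [PK, Finset.mem_filter, Finset.mem_univ, true_and] at hv ⊢
      have := mem_RS_singleton.2 ⟨hf.1, hv⟩
      refine ⟨⟨this, ?_⟩, trivial⟩
      rw [← Z_eq_minimalPeriod this, Z_eq]
    · rintro ⟨f', v⟩ h
      simp only [Finset.mem_filter] at h
      obtain ⟨h, rfl⟩ := h; rfl
    · intro v hv; rfl
  have h2 := card_PK (d := d) hk
  rw [h1] at h2
  apply Nat.eq_of_mul_eq_mul_left hk
  linarith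

theorem card_Un (d : ℕ) (hd : 0 < d) :
    ((Un d).card : ℝ) = (d.factorial : ℝ) / d * ∑ k ∈ Finset.range d, (d : ℝ) ^ k / (k.factorial : ℝ) := by
  have hmap : ∀ f ∈ Un d, Z f ∈ Finset.Icc 1 d := by
    intro f hf
    have hc : Connected f := by simpa [Un] using hf
    rw [Z_eq, Finset.mem_Icc]
    constructor
    · rw [Nat.one_le_iff_ne_zero, ← Nat.pos_iff_ne_zero, Finset.card_pos]
      obtain ⟨x, hx⟩ : ∃ x, x ∈ periodicPts f := by
        have hni : ¬ Injective (fun i : ℕ => f^[i] (⟨0, hd⟩ : Fin d)) := not_injective_infinite_finite _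
        obtain ⟨i, j, hij, hne⟩ : ∃ i j : ℕ, f^[i] (⟨0, hd⟩ : Fin d) = f^[j] ⟨0, hd⟩ ∧ i < j := by
          simp only [Injective] at hni
          push Not at hni
          obtain ⟨i, j, h1, h2⟩ := hni
          rcases lt_or_gt_of_ne h2 with h | h
          · exact ⟨i, j, h1, h⟩
          · exact ⟨j, i, h1.symm, h⟩
        refine ⟨f^[i] ⟨0, hd⟩, j - i, by omega, ?_⟩
        rw [IsPeriodicPt, IsFixedPt, ← iterate_add_apply, Nat.sub_add_cancel hne.le, hij]
      obtain ⟨t, ht, h⟩ := hx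
      exact ⟨x, by simpa using ⟨t, ht, h⟩⟩
    · exact (Finset.card_le_univ _).trans (by simp)
  rw [Finset.card_eq_sum_card_fiberwise hmap, ← Finset.Ico_add_one_right_eq_Icc,
    Finset.sum_Ico_eq_sum_range, Nat.cast_sum, Nat.add_sub_cancel, ← Finset.sum_range_reflect, Finset.mul_sum]
  refine Finset.sum_congr rfl fun j hj => ?_
  have hj' := Finset.mem_range.1 hj
  have e : 1 + (d - 1 - j) = d - j := by omega
  rw [e]
  have h1 := card_Un_Z (d := d) (k := d - j) (by omega)
  have h2 : (((Un d).filter fun f => Z f = d - j).card : ℝ) * (d : ℝ) ^ (d - j) =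
    (d.descFactorial (d - j) : ℝ) * (d : ℝ) ^ (d - 1) := by exact_mod_cast h1
  have h3 : (j.factorial : ℝ) * (d.descFactorial (d - j) : ℝ) = d.factorial := by
    have := Nat.factorial_mul_descFactorial (n := d) (k := d - j) (by omega)
    rw [show d - (d - j) = j by omega] at this
    exact_mod_cast this
  have hd' : (d : ℝ) ≠ 0 := by positivity
  have hjf : (j.factorial : ℝ) ≠ 0 := by positivity
  have h4 : (d : ℝ) ^ (d - j) * (d : ℝ) ^ j = d * (d : ℝ) ^ (d - 1) := by
    rw [← pow_add, ← pow_succ']; congr 1; omega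
  rw [div_mul_div_comm, eq_div_iff (by positivity), ← h3]
  apply mul_right_cancel₀ (b := (d : ℝ) ^ (d - j)) (by positivity)
  linear_combination (d : ℝ) * j.factorial * h2 - (j.factorial : ℝ) * d.descFactorial (d - j) * h4

theorem c_eq (d : ℕ) (hd : 0 < d) :
    c d = (d : ℝ) ^ d * Real.exp (-(d : ℝ)) / d.factorial -
      Real.exp (-(d : ℝ)) * (∑ k ∈ Finset.range d, (d : ℝ) ^ k / (k.factorial : ℝ)) / d := by
  have hS : 0 < ∑ k ∈ Finset.range d, (d : ℝ) ^ k / (k.factorial : ℝ) :=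
    Finset.sum_pos (fun k _ => by positivity) ⟨0, by simpa using hd⟩
  have hz : ∑ f ∈ Un d, (Z f : ℝ) = (d : ℝ) ^ d := by exact_mod_cast sum_Z d hd
  rw [c, kappa, card_Un d hd, hz]
  have : (0:ℝ) < d := by exact_mod_cast hd
  field_simp

theorem c_zero : c 0 = 0 := by simp [c]

theorem c_nonneg (d : ℕ) : 0 ≤ c d := by
  rcases Nat.eq_zero_or_pos d with rfl | hd
  · rw [c_zero]
  have hd' : (0:ℝ) < d := by exact_mod_cast hd
  rw [c_eq d hd]
  have h : ∑ k ∈ Finset.range d, (d : ℝ) ^ k / (k.factorial : ℝ) ≤ d * ((d : ℝ) ^ d / d.factorial) := by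
    have : ∀ k ∈ Finset.range d, (d : ℝ) ^ k / (k.factorial : ℝ) ≤ (d : ℝ) ^ d / d.factorial := by
      intro k hk
      have hk := (Finset.mem_range.1 hk).le
      rw [div_le_div_iff₀ (by positivity) (by positivity)]
      have h1 : (d.factorial : ℝ) ≤ k.factorial * (d : ℝ) ^ (d - k) := by
        have h2 := Nat.factorial_mul_descFactorial (n := d) (k := d - k) (by omega)
        rw [show d - (d - k) = k by omega] at h2
        rw [← h2]
        have h3 := Nat.descFactorial_le_pow d (d - k)
        exact_mod_cast Nat.mul_le_mul_left _ h3
      calc (d : ℝ) ^ k * d.factorial ≤ (d : ℝ) ^ k * (k.factorial * (d : ℝ) ^ (d - k)) := by gcongr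
        _ = (d : ℝ) ^ (k + (d - k)) * k.factorial := by rw [pow_add]; ring
        _ = _ := by rw [Nat.add_sub_cancel' hk]
    simpa using Finset.sum_le_sum this
  rw [sub_nonneg, div_le_iff₀ hd']
  calc _ ≤ Real.exp (-(d:ℝ)) * (d * ((d : ℝ) ^ d / d.factorial)) := by gcongr
    _ = _ := by ring


theorem td_le_one (d : ℕ) : (d : ℝ) ^ d * Real.exp (-(d : ℝ)) / d.factorial ≤ 1 := by
  have h := Real.pow_div_factorial_le_exp (d : ℝ) (by positivity) d
  calc (d : ℝ) ^ d * Real.exp (-(d : ℝ)) / d.factorial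
      = ((d : ℝ) ^ d / d.factorial) * Real.exp (-(d : ℝ)) := by ring
    _ ≤ Real.exp d * Real.exp (-(d : ℝ)) := by gcongr
    _ = 1 := by rw [← Real.exp_add]; simp

theorem c_le_one (d : ℕ) : c d ≤ 1 := by
  rcases Nat.eq_zero_or_pos d with rfl | hd
  · rw [c_zero]; norm_num
  rw [c_eq d hd]
  have h1 := td_le_one d
  have h2 : 0 ≤ Real.exp (-(d : ℝ)) * (∑ k ∈ Finset.range d, (d : ℝ) ^ k / (k.factorial : ℝ)) / d := by
    positivity
  linarith

theorem ps_mul {P Q : PowerSeries ℝ} {z : ℝ}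
    (hP : Summable fun n => ‖PowerSeries.coeff n P * z ^ n‖)
    (hQ : Summable fun n => ‖PowerSeries.coeff n Q * z ^ n‖) :
    (Summable fun n => ‖PowerSeries.coeff n (P * Q) * z ^ n‖) ∧
    ∑' n, PowerSeries.coeff n (P * Q) * z ^ n =
      (∑' n, PowerSeries.coeff n P * z ^ n) * ∑' n, PowerSeries.coeff n Q * z ^ n := by
  have h : ∀ n, PowerSeries.coeff n (P * Q) * z ^ n =
      ∑ kl ∈ Finset.HasAntidiagonal.antidiagonal n, (PowerSeries.coeff kl.1 P * z ^ kl.1) *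
        (PowerSeries.coeff kl.2 Q * z ^ kl.2) := by
    intro n
    rw [PowerSeries.coeff_mul, Finset.sum_mul]
    refine Finset.sum_congr rfl fun p hp => ?_
    rw [← Finset.HasAntidiagonal.mem_antidiagonal.1 hp, pow_add]; ring
  have h1 := summable_norm_sum_mul_antidiagonal_of_summable_norm
    (f := fun n => PowerSeries.coeff n P * z ^ n) (g := fun n => PowerSeries.coeff n Q * z ^ n) hP hQ
  have h2 := tsum_mul_tsum_eq_tsum_sum_antidiagonal_of_summable_norm
    (f := fun n => PowerSeries.coeff n P * z ^ n) (g := fun n => PowerSeries.coeff n Q * z ^ n) hP hQ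
  constructor
  · refine h1.congr fun n => ?_
    rw [h n]
  · rw [h2]
    exact tsum_congr h

theorem ps_pow {P : PowerSeries ℝ} {z : ℝ}
    (hP : Summable fun n => ‖PowerSeries.coeff n P * z ^ n‖) (k : ℕ) :
    (Summable fun n => ‖PowerSeries.coeff n (P ^ k) * z ^ n‖) ∧
    ∑' n, PowerSeries.coeff n (P ^ k) * z ^ n = (∑' n, PowerSeries.coeff n P * z ^ n) ^ k := by
  induction k with
  | zero =>
    have h : ∀ n, n ∉ ({0} : Finset ℕ) → PowerSeries.coeff n (P ^ 0) * z ^ n = 0 := by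
      intro n hn
      simp at hn
      simp [PowerSeries.coeff_one, hn]
    constructor
    · apply summable_of_ne_finset_zero (s := {0})
      intro n hn; rw [h n hn, norm_zero]
    · rw [tsum_eq_sum h]; simp
  | succ k ih =>
    have := ps_mul ih.1 hP
    rw [pow_succ, pow_succ, ← ih.2]
    exact this

theorem ps_pow_nonneg {P : PowerSeries ℝ} (hP : ∀ n, 0 ≤ PowerSeries.coeff n P) (k n : ℕ) :
    0 ≤ PowerSeries.coeff n (P ^ k) := by
  induction k generalizing n with
  | zero => simp only [pow_zero, PowerSeries.coeff_one]; split_ifs <;> norm_num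
  | succ k ih =>
    rw [pow_succ, PowerSeries.coeff_mul]
    exact Finset.sum_nonneg fun p _ => mul_nonneg (ih _) (hP _)

theorem c_summable {z : ℝ} (hz : |z| < 1) : Summable fun d => ‖c d * z ^ d‖ := by
  refine Summable.of_nonneg_of_le (fun _ => norm_nonneg _) (fun d => ?_)
    (summable_geometric_of_lt_one (abs_nonneg z) hz)
  rw [norm_mul, norm_pow, Real.norm_eq_abs, Real.norm_eq_abs, abs_of_nonneg (c_nonneg d)]
  exact mul_le_of_le_one_left (by positivity) (c_le_one d)

def PC : PowerSeries ℝ := PowerSeries.mk c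

def aa (n : ℕ) : ℝ := ∑' k : ℕ, PowerSeries.coeff n (PC ^ k) / k.factorial

theorem aa_nonneg (n : ℕ) : 0 ≤ aa n :=
  tsum_nonneg fun k => div_nonneg (ps_pow_nonneg (fun n => by simp [PC, c_nonneg]) k n) (by positivity)

theorem aa_hasSum {z : ℝ} (hz : |z| < 1) :
    HasSum (fun n => aa n * z ^ n) (Real.exp (∑' d : ℕ, c d * z ^ d)) := by
  have hP : ∀ {w : ℝ}, |w| < 1 → Summable fun n => ‖PowerSeries.coeff n PC * w ^ n‖ := by
    intro w hw; simpa [PC] using c_summable hw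
  set u : ℕ × ℕ → ℝ := fun p => PowerSeries.coeff p.2 (PC ^ p.1) / p.1.factorial * z ^ p.2 with hu
  have hnn : ∀ n, 0 ≤ PowerSeries.coeff n PC := fun n => by simp [PC, c_nonneg]
  have hus : Summable u := by
    apply Summable.of_norm
    rw [summable_prod_of_nonneg (fun _ => norm_nonneg _)]
    have habs : ∀ k n, ‖u (k, n)‖ = (PowerSeries.coeff n (PC ^ k) * |z| ^ n) * (1 / k.factorial) := by
      intro k n
      simp only [hu]
      rw [norm_mul, norm_pow, Real.norm_eq_abs, Real.norm_eq_abs, abs_of_nonneg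
        (div_nonneg (ps_pow_nonneg hnn k n) (by positivity))]
      ring
    have hk := fun k => ps_pow (hP (w := |z|) (by simpa using hz)) k
    constructor
    · intro k
      simp_rw [habs]
      exact ((hk k).1.of_norm).mul_right _
    · simp_rw [habs, tsum_mul_right, (hk _).2]
      simpa [div_eq_mul_inv] using
        Real.summable_pow_div_factorial (∑' n, PowerSeries.coeff n PC * |z| ^ n)
  have h1 : ∑' p, u p = Real.exp (∑' d : ℕ, c d * z ^ d) := by
    rw [hus.tsum_prod]
    have : ∀ k, ∑' n, u (k, n) = (∑' d : ℕ, c d * z ^ d) ^ k / k.factorial := by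
      intro k
      have := (ps_pow (hP hz) k).2
      simp only [PC, PowerSeries.coeff_mk] at this
      rw [← this]
      rw [← tsum_div_const]
      refine tsum_congr fun n => ?_
      simp only [hu, PC]; ring
    simp_rw [this]
    rw [Real.exp_eq_exp_ℝ, NormedSpace.exp_eq_tsum_div]
  have hsw : HasSum (u ∘ Prod.swap) (Real.exp (∑' d : ℕ, c d * z ^ d)) := by
    rw [← h1]
    exact (Equiv.prodComm ℕ ℕ).hasSum_iff.2 hus.hasSum
  have h2 := hsw.prod_fiberwise (fun n => (hsw.summable.prod_factor n).hasSum)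
  convert h2 using 2 with n
  simp only [hu, Function.comp, Prod.swap, tsum_mul_right, aa]

theorem F_hasSum {z : ℝ} (hz : |z| < 1) :
    HasSum (fun n => (∑ m ∈ Finset.range (n + 1), aa m) * z ^ n) (F z) := by
  have h1 := aa_hasSum hz
  have hg : Summable fun n => ‖z ^ n‖ := by
    simpa using summable_geometric_of_lt_one (abs_nonneg z) hz
  have h1a := aa_hasSum (z := |z|) (by simpa using hz)
  have h1n : Summable fun n => ‖aa n * z ^ n‖ := by
    convert h1a.summable using 2 with n
    rw [norm_mul, norm_pow, Real.norm_eq_abs, Real.norm_eq_abs, abs_of_nonneg (aa_nonneg n)]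
  have h2 := summable_norm_sum_mul_range_of_summable_norm h1n hg
  have h3 := tsum_mul_tsum_eq_tsum_sum_range_of_summable_norm h1n hg
  have h4 : ∀ n, ∑ k ∈ Finset.range (n + 1), aa k * z ^ k * z ^ (n - k) =
      (∑ m ∈ Finset.range (n + 1), aa m) * z ^ n := by
    intro n
    rw [Finset.sum_mul]
    refine Finset.sum_congr rfl fun k hk => ?_
    rw [mul_assoc, ← pow_add, Nat.add_sub_cancel' (by simpa [Nat.lt_succ_iff] using hk)]
  simp_rw [h4] at h2 h3
  have h5 := h2.of_norm.hasSum
  rw [← h3, h1.tsum_eq, tsum_geometric_of_norm_lt_one (by simpa using hz)] at h5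
  rw [F, one_div, mul_comm]
  exact h5

theorem mu_eq (n : ℕ) : mu n = ∑ m ∈ Finset.range (n + 1), aa m := by
  have h1 : HasFPowerSeriesAt F (FormalMultilinearSeries.ofScalars ℝ
      (fun n => ∑ m ∈ Finset.range (n + 1), aa m)) 0 := by
    rw [hasFPowerSeriesAt_iff]
    have : ∀ᶠ z : ℝ in nhds 0, |z| < 1 := by
      have := Metric.ball_mem_nhds (0 : ℝ) one_pos
      filter_upwards [this] with z hz
      simpa using hz
    filter_upwards [this] with z hz
    have := F_hasSum hz
    simp only [FormalMultilinearSeries.coeff_ofScalars, zero_add, smul_eq_mul]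
    simpa only [mul_comm] using this
  have h2 := (h1.analyticAt).hasFPowerSeriesAt
  have h3 := h2.eq_formalMultilinearSeries h1
  have h4 := congrFun (FormalMultilinearSeries.ofScalars_series_injective ℝ ℝ h3) n
  exact h4


def hh (s x : ℝ) : ℝ := x ^ ((1:ℝ)/2 - 1) * Real.exp (-(s * x))

theorem hh_nonneg (s : ℝ) {x : ℝ} (hx : 0 ≤ x) : 0 ≤ hh s x := by
  unfold hh; positivity

theorem hh_anti {s x y : ℝ} (hs : 0 < s) (hx : 0 < x) (hxy : x ≤ y) : hh s y ≤ hh s x := by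
  unfold hh
  have : y ^ ((1:ℝ)/2 - 1) ≤ x ^ ((1:ℝ)/2 - 1) :=
    Real.rpow_le_rpow_of_nonpos hx hxy (by norm_num)
  have h2 : (0:ℝ) ≤ x ^ ((1:ℝ)/2 - 1) := by positivity
  gcongr

theorem hh_integral {s : ℝ} (hs : 0 < s) :
    ∫ x in Set.Ioi (0:ℝ), hh s x = Real.sqrt (Real.pi / s) := by
  have := Real.integral_rpow_mul_exp_neg_mul_Ioi (a := 1/2) (r := s) (by norm_num) hs
  unfold hh
  rw [this, Real.Gamma_one_half_eq, ← Real.sqrt_eq_rpow, ← Real.sqrt_mul (by positivity)]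
  congr 1; ring

theorem hh_int {s : ℝ} (hs : 0 < s) : MeasureTheory.IntegrableOn (hh s) (Set.Ioi 0) := by
  by_contra h
  have h1 := MeasureTheory.integral_undef h
  rw [hh_integral hs] at h1
  have : 0 < Real.sqrt (Real.pi / s) := by have := Real.pi_pos; positivity
  linarith

theorem hh_ii {s : ℝ} (hs : 0 < s) {a b : ℝ} (ha : 0 ≤ a) (hb : 0 ≤ b) :
    IntervalIntegrable (hh s) MeasureTheory.volume a b := by
  refine ⟨(hh_int hs).mono_set ?_, (hh_int hs).mono_set ?_⟩
  · intro x hx; exact lt_of_le_of_lt ha hx.1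
  · intro x hx; exact lt_of_le_of_lt hb hx.1

theorem hh_step_le {s : ℝ} (hs : 0 < s) (j : ℕ) :
    hh s ((j:ℝ)+1) ≤ ∫ x in (j:ℝ)..((j+1 : ℕ):ℝ), hh s x := by
  have h := intervalIntegral.integral_mono_on_of_le_Ioo (μ := MeasureTheory.volume)
    (f := fun _ => hh s ((j:ℝ)+1)) (g := hh s) (a := (j:ℝ)) (b := ((j+1:ℕ):ℝ)) (by simp)
    (by simp) (hh_ii hs (by positivity) (by positivity)) (by
      intro x hx
      push_cast at hx
      have h0 : (0:ℝ) ≤ j := by positivity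
      exact hh_anti hs (lt_of_le_of_lt h0 hx.1) hx.2.le)
  simpa using h

theorem hh_step_ge {s : ℝ} (hs : 0 < s) (j : ℕ) :
    ∫ x in ((j+1:ℕ):ℝ)..((j+1+1 : ℕ):ℝ), hh s x ≤ hh s ((j:ℝ)+1) := by
  have h := intervalIntegral.integral_mono_on_of_le_Ioo (μ := MeasureTheory.volume)
    (g := fun _ => hh s ((j:ℝ)+1)) (f := hh s) (a := ((j+1:ℕ):ℝ)) (b := ((j+1+1:ℕ):ℝ)) (by simp)
    (hh_ii hs (by positivity) (by positivity)) (by simp) (by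
      intro x hx
      push_cast at hx
      exact hh_anti hs (by positivity) hx.1.le)
  simpa using h

theorem hh_partial {s : ℝ} (hs : 0 < s) (N : ℕ) :
    ∑ j ∈ Finset.range N, hh s ((j:ℝ)+1) ≤ Real.sqrt (Real.pi / s) := by
  calc _ ≤ ∑ j ∈ Finset.range N, ∫ x in (j:ℝ)..((j+1 : ℕ):ℝ), hh s x :=
        Finset.sum_le_sum fun j _ => hh_step_le hs j
    _ = ∫ x in ((0:ℕ):ℝ)..(N:ℝ), hh s x :=
        intervalIntegral.sum_integral_adjacent_intervals (a := fun j : ℕ => (j:ℝ))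
          fun j _ => hh_ii hs (by positivity) (by positivity)
    _ = ∫ x in Set.Ioc (0:ℝ) N, hh s x := by
        rw [intervalIntegral.integral_of_le (by simp)]; simp
    _ ≤ ∫ x in Set.Ioi (0:ℝ), hh s x := by
        apply MeasureTheory.setIntegral_mono_set (hh_int hs)
        · filter_upwards [MeasureTheory.ae_restrict_mem measurableSet_Ioi] with x hx
          exact hh_nonneg s (le_of_lt hx)
        · exact (Set.Ioc_subset_Ioi_self).eventuallyLE
    _ = _ := hh_integral hs

theorem hh_summable {s : ℝ} (hs : 0 < s) : Summable fun j : ℕ => hh s ((j:ℝ)+1) :=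
  summable_of_sum_range_le (fun j => hh_nonneg s (by positivity)) (hh_partial hs)

theorem hh_tsum_le {s : ℝ} (hs : 0 < s) : ∑' j : ℕ, hh s ((j:ℝ)+1) ≤ Real.sqrt (Real.pi / s) :=
  Real.tsum_le_of_sum_range_le (fun j => hh_nonneg s (by positivity)) (hh_partial hs)

theorem hh_tsum_ge {s : ℝ} (hs : 0 < s) : Real.sqrt (Real.pi / s) - 2 ≤ ∑' j : ℕ, hh s ((j:ℝ)+1) := by
  have h1 : ∀ N : ℕ, ∫ x in (1:ℝ)..((N+1:ℕ):ℝ), hh s x ≤ ∑' j : ℕ, hh s ((j:ℝ)+1) := by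
    intro N
    calc _ = ∑ j ∈ Finset.range N, ∫ x in ((j+1:ℕ):ℝ)..((j+1+1 : ℕ):ℝ), hh s x := by
          rw [intervalIntegral.sum_integral_adjacent_intervals (a := fun j : ℕ => ((j+1:ℕ):ℝ))
          fun j _ => hh_ii hs (by positivity) (by positivity)]
          simp
      _ ≤ ∑ j ∈ Finset.range N, hh s ((j:ℝ)+1) := Finset.sum_le_sum fun j _ => hh_step_ge hs j
      _ ≤ _ := (hh_summable hs).sum_le_tsum _ (fun j _ => hh_nonneg s (by positivity))
  have h2 : Filter.Tendsto (fun N : ℕ => ∫ x in (1:ℝ)..((N+1:ℕ):ℝ), hh s x) Filter.atTop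
      (nhds (∫ x in Set.Ioi (1:ℝ), hh s x)) := by
    apply MeasureTheory.intervalIntegral_tendsto_integral_Ioi
    · exact (hh_int hs).mono_set (Set.Ioi_subset_Ioi (by norm_num))
    · exact tendsto_natCast_atTop_atTop.comp (Filter.tendsto_add_atTop_nat 1)
  have h3 := le_of_tendsto' h2 h1
  have h4 : ∫ x in Set.Ioi (0:ℝ), hh s x = (∫ x in (0:ℝ)..1, hh s x) + ∫ x in Set.Ioi (1:ℝ), hh s x :=
    (intervalIntegral.integral_interval_add_Ioi (hh_int hs)
      ((hh_int hs).mono_set (Set.Ioi_subset_Ioi (by norm_num)))).symm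
  have h5 : ∫ x in (0:ℝ)..1, hh s x ≤ 2 := by
    have h6 : ∫ x in (0:ℝ)..1, x ^ ((1:ℝ)/2 - 1) = 2 := by
      rw [integral_rpow (Or.inl (by norm_num))]; norm_num
    rw [← h6]
    apply intervalIntegral.integral_mono_on_of_le_Ioo (by norm_num) (hh_ii hs le_rfl (by norm_num))
      (intervalIntegral.intervalIntegrable_rpow' (by norm_num))
    intro x hx
    unfold hh
    have : Real.exp (-(s * x)) ≤ 1 := by
      rw [Real.exp_le_one_iff]; have := hx.1; nlinarith
    have h0 : (0:ℝ) ≤ x ^ ((1:ℝ)/2 - 1) := Real.rpow_nonneg hx.1.le _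
    nlinarith
  rw [hh_integral hs] at h4
  linarith

def td (d : ℕ) : ℝ := (d : ℝ) ^ d * Real.exp (-(d : ℝ)) / d.factorial

theorem td_eq (d : ℕ) (hd : 0 < d) : td d = 1 / (Real.sqrt (2 * d) * Stirling.stirlingSeq d) := by
  unfold td Stirling.stirlingSeq
  have hd' : (0:ℝ) < d := by exact_mod_cast hd
  have : (0:ℝ) < Real.sqrt (2 * d) := by positivity
  rw [div_pow, Real.exp_neg, ← Real.exp_nat_mul, mul_one]
  field_simp

theorem stirling_le (d : ℕ) (hd : 0 < d) :
    Stirling.stirlingSeq d ≤ Real.sqrt Real.pi * Real.exp (1 / (12 * d)) := by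
  have hpos : ∀ n, 0 < Stirling.stirlingSeq (n+1) := Stirling.stirlingSeq'_pos
  set w : ℕ → ℝ := fun n => Real.log (Stirling.stirlingSeq (n+1)) - 1 / (12 * ((n:ℝ)+1)) with hw
  have hmono : Monotone w := by
    apply monotone_nat_of_le_succ
    intro n
    have := Stirling.log_stirlingSeq_sdiff_le (n+1)
    simp only [hw]
    have e : (1:ℝ) / (12 * ((n:ℝ)+1)) - 1 / (12 * (((n+1:ℕ):ℝ)+1)) = 1 / (12 * ((n+1:ℕ):ℝ) * (((n+1:ℕ):ℝ)+1)) := by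
      push_cast; field_simp; ring
    linarith
  have hlim : Filter.Tendsto w Filter.atTop (nhds (Real.log (Real.sqrt Real.pi) - 0)) := by
    have hsp : (0:ℝ) < Real.sqrt Real.pi := Real.sqrt_pos.2 Real.pi_pos
    apply Filter.Tendsto.sub
    · exact ((Real.continuousAt_log hsp.ne').tendsto.comp
        (Stirling.tendsto_stirlingSeq_sqrt_pi.comp (Filter.tendsto_add_atTop_nat 1)))
    · have := (tendsto_one_div_add_atTop_nhds_zero_nat (𝕜 := ℝ)).const_mul (1/12 : ℝ)
      rw [mul_zero] at this
      refine this.congr fun n => ?_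
      field_simp
  obtain ⟨n, rfl⟩ : ∃ n, d = n + 1 := ⟨d - 1, by omega⟩
  have h := hmono.ge_of_tendsto hlim n
  simp only [hw, sub_zero] at h
  have hsp : (0:ℝ) < Real.sqrt Real.pi := Real.sqrt_pos.2 Real.pi_pos
  have h2 : Real.log (Stirling.stirlingSeq (n+1)) ≤ Real.log (Real.sqrt Real.pi) + 1 / (12 * ((n:ℝ)+1)) := by
    linarith
  rw [Real.log_le_iff_le_exp (hpos n), Real.exp_add, Real.exp_log hsp] at h2
  push_cast
  exact h2

theorem td_le (d : ℕ) (hd : 0 < d) : td d ≤ 1 / Real.sqrt (2 * Real.pi) * (d:ℝ) ^ ((1:ℝ)/2 - 1) := by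
  have hd' : (0:ℝ) < d := by exact_mod_cast hd
  have hsp : (0:ℝ) < Real.sqrt Real.pi := Real.sqrt_pos.2 Real.pi_pos
  rw [td_eq d hd, show (1:ℝ)/2 - 1 = -(1/2) by norm_num, Real.rpow_neg hd'.le, ← Real.sqrt_eq_rpow,
    Real.sqrt_mul (by norm_num), Real.sqrt_mul (by norm_num)]
  have := Stirling.sqrt_pi_le_stirlingSeq hd.ne'
  calc 1 / (Real.sqrt 2 * Real.sqrt d * Stirling.stirlingSeq d)
      ≤ 1 / (Real.sqrt 2 * Real.sqrt d * Real.sqrt Real.pi) := by gcongr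
    _ = _ := by field_simp

theorem td_ge (d : ℕ) (hd : 0 < d) :
    1 / Real.sqrt (2 * Real.pi) * ((d:ℝ) ^ ((1:ℝ)/2 - 1) - (d:ℝ) ^ (-(3:ℝ)/2)) ≤ td d := by
  have hd' : (0:ℝ) < d := by exact_mod_cast hd
  have hsp : (0:ℝ) < Real.sqrt Real.pi := Real.sqrt_pos.2 Real.pi_pos
  have e1 : (d:ℝ) ^ (-(3:ℝ)/2) = (d:ℝ) ^ ((1:ℝ)/2 - 1) * (1 / d) := by
    rw [show (-(3:ℝ)/2) = ((1:ℝ)/2-1) + (-1) by norm_num, Real.rpow_add hd', Real.rpow_neg_one]; simp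
  rw [e1, td_eq d hd, show (1:ℝ)/2 - 1 = -(1/2) by norm_num, Real.rpow_neg hd'.le, ← Real.sqrt_eq_rpow,
    Real.sqrt_mul (by norm_num), Real.sqrt_mul (by norm_num)]
  have h1 := stirling_le d hd
  have h0 : 0 < Stirling.stirlingSeq d := lt_of_lt_of_le hsp (Stirling.sqrt_pi_le_stirlingSeq hd.ne')
  have h2 : 1 - 1 / (d:ℝ) ≤ Real.exp (-(1 / (12 * d))) := by
    have := Real.add_one_le_exp (-(1 / (12 * (d:ℝ))))
    have h3 : 1 / (12 * (d:ℝ)) ≤ 1 / d := by gcongr; linarith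
    linarith
  calc _ = 1 / (Real.sqrt 2 * Real.sqrt d * Real.sqrt Real.pi) * (1 - 1 / (d:ℝ)) := by
        field_simp
    _ ≤ 1 / (Real.sqrt 2 * Real.sqrt d * Real.sqrt Real.pi) * Real.exp (-(1 / (12 * d))) := by gcongr
    _ = 1 / (Real.sqrt 2 * Real.sqrt d * (Real.sqrt Real.pi * Real.exp (1 / (12 * d)))) := by
        rw [Real.exp_neg]; field_simp
    _ ≤ _ := by gcongr

def AA (s : ℝ) : ℝ := ∑' j : ℕ, td (j+1) * Real.exp (-(s * ((j:ℝ)+1)))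

theorem td_nonneg (d : ℕ) : 0 ≤ td d := by unfold td; positivity

theorem AA_term_le (s : ℝ) (j : ℕ) : td (j+1) * Real.exp (-(s * ((j:ℝ)+1))) ≤
    1 / Real.sqrt (2 * Real.pi) * hh s ((j:ℝ)+1) := by
  have := td_le (j+1) (by omega)
  push_cast at this
  unfold hh
  rw [← mul_assoc]
  gcongr

theorem AA_summable {s : ℝ} (hs : 0 < s) :
    Summable fun j : ℕ => td (j+1) * Real.exp (-(s * ((j:ℝ)+1))) :=
  Summable.of_nonneg_of_le (fun j => mul_nonneg (td_nonneg _) (Real.exp_pos _).le)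
    (AA_term_le s) ((hh_summable hs).mul_left _)

theorem phi_eq {s : ℝ} (hs : 0 < s) :
    1 / Real.sqrt (2 * Real.pi) * Real.sqrt (Real.pi / s) = 1 / Real.sqrt (2 * s) := by
  have hsp : (0:ℝ) < Real.sqrt Real.pi := Real.sqrt_pos.2 Real.pi_pos
  rw [Real.sqrt_mul (by norm_num), Real.sqrt_mul (by norm_num), Real.sqrt_div Real.pi_pos.le]
  field_simp

theorem AA_le {s : ℝ} (hs : 0 < s) : AA s ≤ 1 / Real.sqrt (2 * s) := by
  rw [← phi_eq hs]
  calc AA s ≤ ∑' j : ℕ, 1 / Real.sqrt (2 * Real.pi) * hh s ((j:ℝ)+1) :=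
        (AA_summable hs).tsum_le_tsum (AA_term_le s) ((hh_summable hs).mul_left _)
    _ = 1 / Real.sqrt (2 * Real.pi) * ∑' j : ℕ, hh s ((j:ℝ)+1) := tsum_mul_left
    _ ≤ _ := by gcongr; exact hh_tsum_le hs

theorem AA_ge : ∃ C : ℝ, 0 ≤ C ∧ ∀ s : ℝ, 0 < s → 1 / Real.sqrt (2 * s) - C ≤ AA s := by
  have hsum : Summable fun j : ℕ => ((j:ℝ)+1) ^ (-(3:ℝ)/2) := by
    have := (Real.summable_nat_rpow (p := -(3:ℝ)/2)).2 (by norm_num)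
    have := (summable_nat_add_iff 1).2 this
    simpa using this
  set K := ∑' j : ℕ, ((j:ℝ)+1) ^ (-(3:ℝ)/2) with hK
  have hK0 : 0 ≤ K := tsum_nonneg fun j => by positivity
  refine ⟨1 / Real.sqrt (2 * Real.pi) * (2 + K), by positivity, fun s hs => ?_⟩
  rw [← phi_eq hs]
  have h1 := hh_tsum_ge hs
  calc _ = 1 / Real.sqrt (2 * Real.pi) * ((Real.sqrt (Real.pi / s) - 2) - K) := by ring
    _ ≤ 1 / Real.sqrt (2 * Real.pi) * ((∑' j : ℕ, hh s ((j:ℝ)+1)) - K) := by gcongr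
    _ = ∑' j : ℕ, 1 / Real.sqrt (2 * Real.pi) * (hh s ((j:ℝ)+1) - ((j:ℝ)+1) ^ (-(3:ℝ)/2)) := by
        rw [tsum_mul_left, (hh_summable hs).tsum_sub hsum]
    _ ≤ AA s := by
        refine Summable.tsum_le_tsum (fun j => ?_) (((hh_summable hs).sub hsum).mul_left _) (AA_summable hs)
        have := td_ge (j+1) (by omega)
        push_cast at this
        have he : Real.exp (-(s * ((j:ℝ)+1))) ≤ 1 := by
          rw [Real.exp_le_one_iff]; have : 0 ≤ s * ((j:ℝ)+1) := by positivity
          linarith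
        have h3 : 0 ≤ ((j:ℝ)+1) ^ (-(3:ℝ)/2) := by positivity
        calc _ ≤ 1 / Real.sqrt (2 * Real.pi) * (hh s ((j:ℝ)+1) - ((j:ℝ)+1) ^ (-(3:ℝ)/2) * Real.exp (-(s * ((j:ℝ)+1)))) := by
              gcongr; exact mul_le_of_le_one_right h3 he
          _ = (1 / Real.sqrt (2 * Real.pi) * (((j:ℝ)+1) ^ ((1:ℝ)/2 - 1) - ((j:ℝ)+1) ^ (-(3:ℝ)/2))) * Real.exp (-(s * ((j:ℝ)+1))) := by
              unfold hh; ring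
          _ ≤ _ := by gcongr


def bd (d : ℕ) : ℝ := Real.exp (-(d : ℝ)) * (∑ k ∈ Finset.range d, (d : ℝ) ^ k / (k.factorial : ℝ)) / d

theorem bd_nonneg (d : ℕ) : 0 ≤ bd d := by unfold bd; positivity

theorem bd_le (d : ℕ) : bd d ≤ 1 / d := by
  unfold bd
  have := Real.sum_le_exp_of_nonneg (x := (d:ℝ)) (by positivity) d
  gcongr
  calc _ ≤ Real.exp (-(d:ℝ)) * Real.exp d := by gcongr
    _ = 1 := by rw [← Real.exp_add]; simp

def BB (s : ℝ) : ℝ := ∑' j : ℕ, bd (j+1) * Real.exp (-(s * ((j:ℝ)+1)))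

theorem exp_eq_pow (s : ℝ) (j : ℕ) : Real.exp (-(s * ((j:ℝ)+1))) = Real.exp (-s) ^ (j+1) := by
  rw [← Real.exp_nat_mul]; congr 1; push_cast; ring

theorem geo_hasSum {s : ℝ} (hs : 0 < s) :
    HasSum (fun j : ℕ => Real.exp (-(s * ((j:ℝ)+1)))) (Real.exp (-s) * (1 - Real.exp (-s))⁻¹) := by
  have h1 : Real.exp (-s) < 1 := by rw [Real.exp_lt_one_iff]; linarith
  have := (hasSum_geometric_of_lt_one (Real.exp_pos _).le h1).mul_left (Real.exp (-s))
  simpa only [exp_eq_pow, pow_succ'] using this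

theorem BB_summable {s : ℝ} (hs : 0 < s) :
    Summable fun j : ℕ => bd (j+1) * Real.exp (-(s * ((j:ℝ)+1))) := by
  refine Summable.of_nonneg_of_le (fun j => mul_nonneg (bd_nonneg _) (Real.exp_pos _).le) (fun j => ?_)
    (geo_hasSum hs).summable
  refine mul_le_of_le_one_left (Real.exp_pos _).le ((bd_le _).trans ?_)
  rw [div_le_one (by positivity)]; simp

theorem BB_nonneg (s : ℝ) : 0 ≤ BB s :=
  tsum_nonneg fun j => mul_nonneg (bd_nonneg _) (Real.exp_pos _).le

theorem BB_anti {s t : ℝ} (hs : 0 < s) (hst : s ≤ t) : BB t ≤ BB s := by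
  refine (BB_summable (hs.trans_le hst)).tsum_le_tsum (fun j => ?_) (BB_summable hs)
  have := bd_nonneg (j+1)
  gcongr

theorem one_sub_exp_ge {s : ℝ} (hs : 0 < s) (hs1 : s ≤ 1) : s / 2 ≤ 1 - Real.exp (-s) := by
  have h := Real.add_one_le_exp s
  have h2 : Real.exp (-s) * Real.exp s = 1 := by rw [← Real.exp_add]; simp
  have h3 := Real.exp_pos (-s)
  have h4 : Real.exp (-s) * (s + 1) ≤ 1 := by
    calc Real.exp (-s) * (s + 1) ≤ Real.exp (-s) * Real.exp s := by gcongr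
      _ = 1 := h2
  nlinarith

theorem BB_diff {s t : ℝ} (hs : 0 < s) (hst : s ≤ t) : BB s - BB t ≤ (t - s) / s := by
  have ht := hs.trans_le hst
  unfold BB
  rw [← (BB_summable hs).tsum_sub (BB_summable ht)]
  have hg := (geo_hasSum hs).mul_left (t - s)
  calc _ ≤ (t - s) * (Real.exp (-s) * (1 - Real.exp (-s))⁻¹) := by
        rw [← hg.tsum_eq]
        refine Summable.tsum_le_tsum (fun j => ?_) ((BB_summable hs).sub (BB_summable ht)) hg.summable
        have hb := bd_le (j+1)
        have hb0 := bd_nonneg (j+1)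
        have he : Real.exp (-(t * ((j:ℝ)+1))) = Real.exp (-(s * ((j:ℝ)+1))) * Real.exp (-((t - s) * ((j:ℝ)+1))) := by
          rw [← Real.exp_add]; congr 1; ring
        have h1 := Real.add_one_le_exp (-((t - s) * ((j:ℝ)+1)))
        have hj : (0:ℝ) < (j:ℝ)+1 := by positivity
        rw [he]
        have hE := Real.exp_pos (-(s * ((j:ℝ)+1)))
        push_cast at hb
        have h2 : bd (j+1) * ((j:ℝ)+1) ≤ 1 := by rwa [le_div_iff₀ hj] at hb
        calc _ = Real.exp (-(s * ((j:ℝ)+1))) * (bd (j+1) * (1 - Real.exp (-((t - s) * ((j:ℝ)+1))))) := by ring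
          _ ≤ Real.exp (-(s * ((j:ℝ)+1))) * (bd (j+1) * ((t-s) * ((j:ℝ)+1))) := by gcongr; linarith
          _ = Real.exp (-(s * ((j:ℝ)+1))) * ((t-s) * (bd (j+1) * ((j:ℝ)+1))) := by ring
          _ ≤ Real.exp (-(s * ((j:ℝ)+1))) * ((t-s) * 1) := by
              have : 0 ≤ t - s := by linarith
              gcongr
          _ = _ := by ring
    _ ≤ (t - s) * (1 / s) := by
        have h0 : 0 ≤ t - s := by linarith
        have h1 : Real.exp (-s) < 1 := by rw [Real.exp_lt_one_iff]; linarith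
        have h : Real.exp (-s) * (1 - Real.exp (-s))⁻¹ ≤ 1 / s := by
          rw [← div_eq_mul_inv, div_le_div_iff₀ (by linarith) hs]
          have h := Real.add_one_le_exp s
          have h2 : Real.exp (-s) * Real.exp s = 1 := by rw [← Real.exp_add]; simp
          have h3 := Real.exp_pos (-s)
          nlinarith
        gcongr
    _ = _ := by ring

theorem BB_le {s : ℝ} (hs : 0 < s) : BB s ≤ -Real.log (1 - Real.exp (-s)) := by
  have h1 : Real.exp (-s) < 1 := by rw [Real.exp_lt_one_iff]; linarith
  have h := Real.hasSum_pow_div_log_of_abs_lt_one (x := Real.exp (-s)) (by rwa [abs_of_pos (Real.exp_pos _)])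
  rw [← h.tsum_eq]
  refine (BB_summable hs).tsum_le_tsum (fun j => ?_) h.summable
  have hb := bd_le (j+1)
  push_cast at hb
  rw [exp_eq_pow]
  calc _ ≤ 1 / ((j:ℝ)+1) * Real.exp (-s) ^ (j+1) := by gcongr
    _ = _ := by ring

theorem log_bound {s y : ℝ} (hs : 0 < s) (hs1 : s ≤ 1) (hy : 1 ≤ y) (h : 1 / (2 * y ^ 4) ≤ s) :
    -Real.log (1 - Real.exp (-s)) ≤ 6 * y := by
  have h1 := one_sub_exp_ge hs hs1
  have hy0 : 0 < y := by linarith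
  have h2 : 1 / (4 * y ^ 4) ≤ 1 - Real.exp (-s) := by
    have : 1 / (4 * y ^ 4) = 1 / (2 * y ^ 4) / 2 := by field_simp; norm_num
    linarith
  have h3 := Real.log_le_log (by positivity) h2
  rw [one_div, Real.log_inv, Real.log_mul (by norm_num) (by positivity), Real.log_pow] at h3
  have h4 := Real.log_le_sub_one_of_pos hy0
  have h5 : Real.log 4 ≤ 2 := by
    rw [show (4:ℝ) = 2 ^ 2 by norm_num, Real.log_pow]
    have := Real.log_two_lt_d9
    push_cast; linarith
  push_cast at h3
  linarith

def GG (s : ℝ) : ℝ := ∑' d : ℕ, c d * Real.exp (-s) ^ d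

theorem abs_exp_lt {s : ℝ} (hs : 0 < s) : |Real.exp (-s)| < 1 := by
  rw [abs_of_pos (Real.exp_pos _), Real.exp_lt_one_iff]; linarith

theorem GG_eq {s : ℝ} (hs : 0 < s) : GG s = AA s - BB s := by
  unfold GG
  rw [((c_summable (abs_exp_lt hs)).of_norm).tsum_eq_zero_add, c_zero, zero_mul, zero_add]
  unfold AA BB
  rw [← (AA_summable hs).tsum_sub (BB_summable hs)]
  refine tsum_congr fun j => ?_
  rw [c_eq (j+1) (by omega), exp_eq_pow]
  unfold td bd
  ring

theorem aa_exp {s : ℝ} (hs : 0 < s) :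
    HasSum (fun n : ℕ => aa n * Real.exp (-(s * n))) (Real.exp (GG s)) := by
  have := aa_hasSum (abs_exp_lt hs)
  have e : ∀ n : ℕ, Real.exp (-(s * n)) = Real.exp (-s) ^ n := fun n => by
    rw [← Real.exp_nat_mul]; congr 1; ring
  simp_rw [e]
  exact this

theorem mu_upper {s : ℝ} (hs : 0 < s) (n : ℕ) :
    mu n * Real.exp (-(s * n)) ≤ Real.exp (GG s) * (1 - Real.exp (-s))⁻¹ := by
  have h := F_hasSum (abs_exp_lt hs)
  have h1 := le_hasSum h n (fun m _ => mul_nonneg (Finset.sum_nonneg fun k _ => aa_nonneg k) (by positivity))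
  rw [← mu_eq, F, ← Real.exp_nat_mul] at h1
  calc _ = mu n * Real.exp (n * -s) := by congr 2; ring
    _ ≤ _ := h1
    _ = _ := by unfold GG; rw [one_div, mul_comm]

theorem mu_lower {r s t : ℝ} (hr : 0 < r) (hrs : r < s) (hst : s < t) (n : ℕ) (w : ℝ) :
    Real.exp (GG s) ≤ Real.exp (-(s * (n - w))) * mu n + Real.exp (GG r) * Real.exp (-((s - r) * n))
      + Real.exp (GG t) * Real.exp ((t - s) * (n - w)) := by
  have hs := hr.trans hrs
  have ht := hs.trans hst
  have h1 : HasSum (fun m : ℕ => if m ∈ Finset.range (n+1) then aa m else 0) (mu n) := by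
    rw [mu_eq]
    have := hasSum_sum_of_ne_finset_zero (f := fun m : ℕ => if m ∈ Finset.range (n+1) then aa m else 0)
      (s := Finset.range (n+1)) (fun m hm => by simp only [if_neg hm]) (L := SummationFilter.unconditional ℕ)
    rwa [Finset.sum_congr rfl (fun m hm => if_pos hm)] at this
  have h2 := ((h1.mul_left (Real.exp (-(s * (n - w))))).add
    ((aa_exp hr).mul_right (Real.exp (-((s - r) * n))))).add
    ((aa_exp ht).mul_right (Real.exp ((t - s) * (n - w))))
  refine hasSum_le (fun m => ?_) (aa_exp hs) h2
  have ha := aa_nonneg m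
  have hE : ∀ x : ℝ, 0 ≤ Real.exp x := fun x => (Real.exp_pos x).le
  have p1 : 0 ≤ Real.exp (-(s * (n - w))) * (if m ∈ Finset.range (n+1) then aa m else 0) := by
    split_ifs <;> positivity
  have p2 : 0 ≤ aa m * Real.exp (-(r * m)) * Real.exp (-((s - r) * n)) := by positivity
  have p3 : 0 ≤ aa m * Real.exp (-(t * m)) * Real.exp ((t - s) * (n - w)) := by positivity
  by_cases hm : m ∈ Finset.range (n+1)
  · by_cases hw : (m:ℝ) ≤ n - w
    · have : aa m * Real.exp (-(s * m)) ≤ aa m * Real.exp (-(t * m)) * Real.exp ((t - s) * (n - w)) := by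
        rw [mul_assoc, ← Real.exp_add]
        gcongr
        nlinarith
      linarith
    · push Not at hw
      have : aa m * Real.exp (-(s * m)) ≤ Real.exp (-(s * (n - w))) * (if m ∈ Finset.range (n+1) then aa m else 0) := by
        rw [if_pos hm, mul_comm]
        gcongr
      linarith
  · have hmn : (n:ℝ) ≤ m := by
      simp at hm
      exact_mod_cast (by omega : n ≤ m)
    have : aa m * Real.exp (-(s * m)) ≤ aa m * Real.exp (-(r * m)) * Real.exp (-((s - r) * n)) := by
      rw [mul_assoc, ← Real.exp_add]
      gcongr
      nlinarith
    linarith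

theorem phi_sq {x y : ℝ} (hx : 0 < x) (hy : 0 < y) :
    1 / Real.sqrt (2 * (x ^ 2 / (2 * y ^ 4))) = y ^ 2 / x := by
  have : 2 * (x ^ 2 / (2 * y ^ 4)) = (x / y ^ 2) ^ 2 := by field_simp
  rw [this, Real.sqrt_sq (by positivity)]
  field_simp

theorem upper_final {y : ℝ} (hy : 1 ≤ y) {n : ℕ} (hn : (n:ℝ) = y ^ 6) (hmu : 0 < mu n) :
    Real.log (mu n) ≤ 3 / 2 * y ^ 2 + 6 * y := by
  have hy0 : 0 < y := by linarith
  set s : ℝ := 1 ^ 2 / (2 * y ^ 4) with hs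
  have hs0 : 0 < s := by positivity
  have hs1 : s ≤ 1 := by
    rw [hs, div_le_one (by positivity)]
    have : 1 ≤ y ^ 4 := one_le_pow₀ hy
    linarith
  have h1 := mu_upper hs0 n
  have hp : 0 < 1 - Real.exp (-s) := by have := one_sub_exp_ge hs0 hs1; linarith
  have h2 := Real.log_le_log (by positivity) h1
  rw [Real.log_mul hmu.ne' (Real.exp_pos _).ne', Real.log_exp,
    Real.log_mul (Real.exp_pos _).ne' (by positivity), Real.log_exp, Real.log_inv] at h2
  have h3 := log_bound hs0 hs1 hy (by rw [hs]; norm_num)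
  have h4 := GG_eq hs0
  have h5 := AA_le hs0
  have h6 := BB_nonneg s
  rw [hs, phi_sq one_pos hy0, ← hs] at h5
  have h7 : s * n = y ^ 2 / 2 := by rw [hs, hn]; field_simp
  linarith

theorem lf1 {y q : ℝ} (hq0 : 0 < q) :
    y ^ 2 / (1 + q) - y ^ 2 / (1 + 2 * q) ≤ y ^ 2 * q := by
  have : y ^ 2 / (1 + q) - y ^ 2 / (1 + 2 * q) = y ^ 2 * q / ((1 + q) * (1 + 2 * q)) := by
    field_simp; ring
  rw [this]
  apply div_le_self (by positivity)
  nlinarith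

theorem lf2 {q : ℝ} (hq0 : 0 < q) : q - 5 * q ^ 2 ≤ q / ((1 + 2 * q) * (1 + 3 * q)) := by
  rw [le_div_iff₀ (by positivity)]
  have h3 : 0 ≤ q ^ 3 := by positivity
  have h4 : 0 ≤ q ^ 4 := by positivity
  have : (q - 5 * q ^ 2) * ((1 + 2 * q) * (1 + 3 * q)) = q - 19 * q ^ 3 - 30 * q ^ 4 := by ring
  rw [this]
  linarith

theorem lf2b {y q : ℝ} (hq0 : 0 < q) :
    y ^ 2 / (1 + 3 * q) - y ^ 2 / (1 + 2 * q) ≤ - (y ^ 2 * q) + 5 * (q ^ 2 * y ^ 2) := by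
  have : y ^ 2 / (1 + 3 * q) - y ^ 2 / (1 + 2 * q) = - (y ^ 2 * (q / ((1 + 2 * q) * (1 + 3 * q)))) := by
    field_simp; ring
  rw [this]
  have := mul_le_mul_of_nonneg_left (lf2 hq0) (sq_nonneg y)
  linarith

theorem lf3 {y q : ℝ} (hy0 : 0 < y) (hq0 : 0 < q) (hq1 : q ≤ 1) :
    ((1 + 3 * q) ^ 2 / (2 * y ^ 4) - (1 + 2 * q) ^ 2 / (2 * y ^ 4)) / ((1 + 2 * q) ^ 2 / (2 * y ^ 4)) ≤ 7 := by
  have : ((1 + 3 * q) ^ 2 / (2 * y ^ 4) - (1 + 2 * q) ^ 2 / (2 * y ^ 4)) / ((1 + 2 * q) ^ 2 / (2 * y ^ 4))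
      = (2 * q + 5 * q ^ 2) / (1 + 2 * q) ^ 2 := by
    field_simp; ring
  rw [this, div_le_iff₀ (by positivity)]
  have : 0 ≤ q ^ 2 := sq_nonneg q
  have : 7 * (1 + 2 * q) ^ 2 = 7 + 28 * q + 28 * q ^ 2 := by ring
  linarith

theorem le1 {y q : ℝ} (hy0 : 0 < y) :
    ((1 + 2 * q) ^ 2 / (2 * y ^ 4) - (1 + q) ^ 2 / (2 * y ^ 4)) * y ^ 6
      = y ^ 2 * q + 3 / 2 * (q ^ 2 * y ^ 2) := by
  field_simp; ring

theorem le2 {y q L : ℝ} (hy0 : 0 < y) :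
    ((1 + 3 * q) ^ 2 / (2 * y ^ 4) - (1 + 2 * q) ^ 2 / (2 * y ^ 4)) * (y ^ 6 - L * y ^ 5)
      = y ^ 2 * q + 5 / 2 * (q ^ 2 * y ^ 2) - L * (q * y) - 5 / 2 * L * (q * (q * y)) := by
  field_simp; ring

theorem lk2 {y q L : ℝ} (hy0 : 0 < y) :
    (1 + 2 * q) ^ 2 / (2 * y ^ 4) * (y ^ 6 - L * y ^ 5)
      = (1 + 2 * q) ^ 2 / 2 * y ^ 2 - L * y * ((1 + 2 * q) ^ 2 / 2) := by
  field_simp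

theorem lq9 {q : ℝ} (hq0 : 0 < q) (hq1 : q ≤ 1) : (1 + 2 * q) ^ 2 ≤ 9 := by nlinarith

set_option maxHeartbeats 1000000 in
theorem lower_final {C : ℝ} (hC0 : 0 ≤ C)
    (hC : ∀ s : ℝ, 0 < s → 1 / Real.sqrt (2 * s) - C ≤ AA s) :
    ∃ D Y : ℝ, ∀ y : ℝ, Y ≤ y → ∀ n : ℕ, (n:ℝ) = y ^ 6 →
      0 < mu n ∧ 3 / 2 * y ^ 2 - D * y ≤ Real.log (mu n) := by
  set K : ℝ := C + 2 with hK
  set L : ℝ := 15 / 2 * K + C + 9 with hL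
  refine ⟨9 / 2 * L + 2 * K + C + 7, K + 3, fun y hy n hn => ?_⟩
  have hy1 : 1 ≤ y := by linarith
  have hy0 : 0 < y := by linarith
  set q : ℝ := K / y with hq
  have hqy : q * y = K := by rw [hq]; field_simp
  have hq0 : 0 < q := by rw [hq]; apply div_pos _ hy0; linarith
  have hq1 : q ≤ 1 := by rw [hq, div_le_one hy0]; linarith
  have hqy2 : q ^ 2 * y ^ 2 = K ^ 2 := by rw [← mul_pow, hqy]
  set r : ℝ := (1 + q) ^ 2 / (2 * y ^ 4) with hr
  set s : ℝ := (1 + 2 * q) ^ 2 / (2 * y ^ 4) with hs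
  set t : ℝ := (1 + 3 * q) ^ 2 / (2 * y ^ 4) with ht
  have hr0 : 0 < r := by positivity
  have hs0 : 0 < s := by positivity
  have ht0 : 0 < t := by positivity
  have hrs : r < s := by rw [hr, hs]; gcongr; linarith
  have hst : s < t := by rw [hs, ht]; gcongr; linarith
  have main := mu_lower hr0 hrs hst n (L * y ^ 5)
  have gr := GG_eq hr0
  have gs := GG_eq hs0
  have gt := GG_eq ht0
  have ar := AA_le hr0
  have at1 := AA_le ht0
  have as1 := hC s hs0
  rw [hr, phi_sq (by positivity) hy0, ← hr] at ar
  rw [ht, phi_sq (by positivity) hy0, ← ht] at at1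
  rw [hs, phi_sq (by positivity) hy0, ← hs] at as1
  have b1 := BB_anti hr0 hrs.le
  have b2 := BB_diff hs0 hst.le
  have e1 : (s - r) * n = y ^ 2 * q + 3 / 2 * K ^ 2 := by
    rw [← hqy2, hs, hr, hn]; exact le1 hy0
  have f1 := lf1 (y := y) hq0
  have u1 : GG r - (s - r) * n ≤ GG s - 2 := by
    rw [e1]
    have : C + 2 ≤ 3 / 2 * K ^ 2 := by
      have : 0 ≤ (K - 1) * K := mul_nonneg (by linarith) (by linarith)
      have h2 : (K - 1) * K = K ^ 2 - K := by ring
      linarith [sq_nonneg K]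
    linarith
  have e2 : (t - s) * (n - L * y ^ 5) = y ^ 2 * q + 5 / 2 * K ^ 2 - L * K - 5 / 2 * L * (q * K) := by
    have := le2 (y := y) (q := q) (L := L) hy0
    rw [hqy2, hqy, ← hn] at this
    exact this
  have f2 : y ^ 2 / (1 + 3 * q) - y ^ 2 / (1 + 2 * q) ≤ - (y ^ 2 * q) + 5 * K ^ 2 := by
    have := lf2b (y := y) hq0
    rwa [hqy2] at this
  have f3 : (t - s) / s ≤ 7 := lf3 hy0 hq0 hq1
  have u2 : GG t + (t - s) * (n - L * y ^ 5) ≤ GG s - 2 := by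
    rw [e2]
    have h1 : 15 / 2 * K ^ 2 + C + 9 ≤ L * K := by
      have hCK : 0 ≤ (C + 9) * (K - 1) := mul_nonneg (by linarith) (by linarith)
      have : L * K = 15 / 2 * K ^ 2 + (C + 9) * K := by rw [hL]; ring
      linarith
    have h2 : 0 ≤ L * (q * K) := by
      have hL0 : 0 ≤ L := by linarith
      have hK0 : 0 ≤ K := by linarith
      positivity
    linarith
  have hexp : Real.exp (GG s - 2) ≤ Real.exp (GG s) / 4 := by
    rw [Real.exp_sub]
    have : (4:ℝ) ≤ Real.exp 2 := by
      have h := Real.exp_one_gt_d9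
      have : Real.exp 2 = Real.exp 1 * Real.exp 1 := by rw [← Real.exp_add]; norm_num
      nlinarith
    gcongr
  rw [← Real.exp_add, ← Real.exp_add] at main
  have v1 := Real.exp_le_exp.2 u1
  have v2 := Real.exp_le_exp.2 u2
  rw [sub_eq_add_neg] at v1
  have hes := Real.exp_pos (GG s)
  have m1 : Real.exp (GG s) / 2 ≤ Real.exp (-(s * (n - L * y ^ 5))) * mu n := by linarith
  have hmu : 0 < mu n := by
    have h := Real.exp_pos (-(s * (n - L * y ^ 5)))
    by_contra hneg
    push Not at hneg
    have := mul_nonpos_of_nonneg_of_nonpos h.le hneg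
    linarith
  refine ⟨hmu, ?_⟩
  have m2 := Real.log_le_log (by positivity) m1
  rw [Real.log_div hes.ne' (by norm_num), Real.log_exp, Real.log_mul (Real.exp_pos _).ne' hmu.ne',
    Real.log_exp] at m2
  have hl2 := Real.log_two_lt_d9
  have hs1 : s ≤ 1 := by
    rw [hs, div_le_one (by positivity)]
    have h1 : (1 + 2 * q) ^ 2 ≤ 9 := lq9 hq0 hq1
    have h2 : (3:ℝ) ^ 4 ≤ y ^ 4 := by gcongr; linarith
    linarith
  have hb := (BB_le hs0).trans (log_bound hs0 hs1 hy1 (by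
    rw [hs]; gcongr; exact one_le_pow₀ (by linarith)))
  have k1 : y ^ 2 - 2 * K * y ≤ y ^ 2 / (1 + 2 * q) := by
    have : y ^ 2 - 2 * K * y = y ^ 2 * (1 - 2 * q) := by rw [← hqy]; ring
    rw [this, le_div_iff₀ (by positivity)]
    have : y ^ 2 * (1 - 2 * q) * (1 + 2 * q) = y ^ 2 - 4 * (q ^ 2 * y ^ 2) := by ring
    rw [this, hqy2]
    linarith [sq_nonneg K]
  have k2 : s * (n - L * y ^ 5) = (1 + 2 * q) ^ 2 / 2 * y ^ 2 - L * y * ((1 + 2 * q) ^ 2 / 2) := by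
    rw [hs, hn]; exact lk2 hy0
  have k3 : y ^ 2 / 2 ≤ (1 + 2 * q) ^ 2 / 2 * y ^ 2 := by
    have h1 : 1 ≤ (1 + 2 * q) ^ 2 := one_le_pow₀ (by linarith)
    have := mul_le_mul_of_nonneg_right h1 (sq_nonneg y)
    linarith
  have k4 : L * y * ((1 + 2 * q) ^ 2 / 2) ≤ L * y * (9 / 2) := by
    have : (1 + 2 * q) ^ 2 ≤ 9 := lq9 hq0 hq1
    have : 0 ≤ L := by rw [hL]; linarith
    gcongr
  have k5 : C + 1 ≤ (C + 1) * y := le_mul_of_one_le_right (by linarith) hy1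
  linarith

end

/-- `log μ(n) = (3/2) n^{1/3} + O(n^{1/6})`. -/
theorem mu_asymp :
    ∃ C : ℝ, ∃ N : ℕ, ∀ n : ℕ, N ≤ n →
      |Real.log (mu n) - (3 / 2) * (n : ℝ) ^ ((1 : ℝ) / 3)| ≤ C * (n : ℝ) ^ ((1 : ℝ) / 6) := by
  obtain ⟨C, hC0, hC⟩ := AA_ge
  obtain ⟨D, Y, h⟩ := lower_final hC0 hC
  refine ⟨max D 6, ⌈(max Y 1) ^ 6⌉₊, fun n hn => ?_⟩
  have hn' : (max Y 1) ^ 6 ≤ (n:ℝ) := (Nat.le_ceil _).trans (by exact_mod_cast hn)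
  set y : ℝ := (n:ℝ) ^ ((1:ℝ)/6) with hy
  have hy0 : 0 ≤ y := by positivity
  have h6 : (n:ℝ) = y ^ 6 := by
    rw [hy, ← Real.rpow_natCast, ← Real.rpow_mul (by positivity)]; norm_num
  have h2 : (n:ℝ) ^ ((1:ℝ)/3) = y ^ 2 := by
    rw [hy, ← Real.rpow_natCast, ← Real.rpow_mul (by positivity)]; norm_num
  have hmax : max Y 1 ≤ y := by
    rw [h6] at hn'
    exact le_of_pow_le_pow_left₀ (by norm_num) hy0 hn'
  obtain ⟨hmu, hlow⟩ := h y ((le_max_left _ _).trans hmax) n h6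
  have hup := upper_final ((le_max_right _ _).trans hmax) h6 hmu
  rw [h2, abs_le]
  have h3 : D * y ≤ max D 6 * y := by gcongr; exact le_max_left _ _
  have h4 : 6 * y ≤ max D 6 * y := by gcongr; exact le_max_right _ _
  constructor <;> linarith

end IterMap
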